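/- arXiv:1702.00639 — 4 statements merged into one kernel-verified Lean document; each statement's English description precedes it below -/
import Mathlib

section
/- Let n ≥ 1, let y₁ ≥ y₂ ≥ … ≥ yₙ > 0 and set Y = ⊕_{i=1}^n y_i I₂. Let z̄₁ ≥ z̄₂ ≥ … ≥ z̄ₙ ≥ 1 and let 𝒮 be the set of all 2n×2n real matrices S of the form S = R₁ Z R₂, where R₁ and R₂ are both orthogonal and symplectic, and Z = diag(z₁, 1/z₁, …, zₙ, 1/zₙ) with 1 ≤ z_i ≤ z̄_i for each i. Then the value Σ_{i=1}^n (z̄_i² + z̄_i^{−2}) y_i is the greatest element of the set {tr[S Y Sᵀ] : S ∈ 𝒮}; in particular tr[S Y Sᵀ] ≤ Σ_{i=1}^n (z̄_i² + z̄_i^{−2}) y_i for all S ∈ 𝒮, and equality is attained at S = diag(z̄₁, 1/z̄₁, …, z̄ₙ, 1/z̄ₙ). -/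
open Matrix BigOperators

/-- The standard symplectic form `Ω = ⨁ [[0,1],[-1,0]]`. -/
def Omega (n : ℕ) : Matrix (Fin (2*n)) (Fin (2*n)) ℝ :=
  Matrix.of fun i j =>
    if j.val = i.val + 1 ∧ i.val % 2 = 0 then (1:ℝ)
    else if i.val = j.val + 1 ∧ j.val % 2 = 0 then -1 else 0

/-- The block-diagonal matrix `⨁_{i=1}^n y_i I₂`. -/
noncomputable def pairDiag (n : ℕ) (y : Fin n → ℝ) :
    Matrix (Fin (2*n)) (Fin (2*n)) ℝ :=
  Matrix.diagonal fun i => y ⟨i.val / 2, by have := i.isLt; omega⟩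

/-- The squeezing matrix `Z = diag(z₁, 1/z₁, …, zₙ, 1/zₙ)`. -/
noncomputable def squeezeDiag (n : ℕ) (z : Fin n → ℝ) :
    Matrix (Fin (2*n)) (Fin (2*n)) ℝ :=
  Matrix.diagonal fun i =>
    if i.val % 2 = 0 then z ⟨i.val / 2, by have := i.isLt; omega⟩
    else (z ⟨i.val / 2, by have := i.isLt; omega⟩)⁻¹

/-- A doubly stochastic matrix cannot raise the pairing of two similarly ordered vectors. -/
theorem Monovary.sum_mul_doublyStochastic_mul_le {ι : Type*} [Fintype ι] [DecidableEq ι]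
    {c y : ι → ℝ} (h : Monovary c y) {P : Matrix ι ι ℝ} (hP : P ∈ doublyStochastic ℝ ι) :
    ∑ i, ∑ j, c i * P i j * y j ≤ ∑ i, c i * y i := by
  have hlin : IsLinearMap ℝ fun P : Matrix ι ι ℝ => ∑ i, ∑ j, c i * P i j * y j :=
    ⟨fun A B => by simp only [Matrix.add_apply, mul_add, add_mul, Finset.sum_add_distrib],
     fun r A => by
      simp only [Matrix.smul_apply, smul_eq_mul, Finset.mul_sum]
      exact Finset.sum_congr rfl fun i _ => Finset.sum_congr rfl fun j _ => by ring⟩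
  rw [← SetLike.mem_coe, doublyStochastic_eq_convexHull_permMatrix] at hP
  refine convexHull_min ?_ (convex_halfSpace_le hlin (∑ i, c i * y i)) hP
  rintro _ ⟨σ, rfl⟩
  simpa [Equiv.Perm.permMatrix, PEquiv.toMatrix_apply] using h.sum_mul_comp_perm_le_sum_mul (σ := σ)

theorem add_inv_sq_le_add_inv_sq {a b : ℝ} (ha : 1 ≤ a) (hab : a ≤ b) :
    a ^ 2 + a⁻¹ ^ 2 ≤ b ^ 2 + b⁻¹ ^ 2 := by
  have ha0 : 0 < a := by linarith
  have hb0 : 0 < b := by linarith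
  have hsq : a ^ 2 ≤ b ^ 2 := by gcongr
  have h1 : 1 ≤ a ^ 2 * b ^ 2 := one_le_mul_of_one_le_of_one_le (one_le_pow₀ ha)
    (one_le_pow₀ (ha.trans hab))
  have key : b ^ 2 + b⁻¹ ^ 2 - (a ^ 2 + a⁻¹ ^ 2)
      = (b ^ 2 - a ^ 2) * (a ^ 2 * b ^ 2 - 1) / (a ^ 2 * b ^ 2) := by
    field_simp
    ring
  have : 0 ≤ (b ^ 2 - a ^ 2) * (a ^ 2 * b ^ 2 - 1) / (a ^ 2 * b ^ 2) :=
    div_nonneg (mul_nonneg (by linarith) (by linarith)) (by positivity)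
  linarith

theorem trace_diagonal_conj {ι : Type*} [Fintype ι] [DecidableEq ι] (d w : ι → ℝ)
    (R : Matrix ι ι ℝ) :
    trace (diagonal d * R * diagonal w * (diagonal d * R)ᵀ)
      = ∑ a, ∑ b, d a ^ 2 * R a b ^ 2 * w b := by
  simp only [trace, diag_apply]
  refine Finset.sum_congr rfl fun a _ => ?_
  rw [mul_apply]
  refine Finset.sum_congr rfl fun b _ => ?_
  rw [mul_diagonal, transpose_apply, diagonal_mul]
  ring

/-- The position index of the `i`-th mode. -/
def evenIdx {n : ℕ} (i : Fin n) : Fin (2 * n) := ⟨2 * i, by omega⟩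

/-- The momentum index of the `i`-th mode. -/
def oddIdx {n : ℕ} (i : Fin n) : Fin (2 * n) := ⟨2 * i + 1, by omega⟩

theorem sum_fin_two_mul {n : ℕ} (f : Fin (2 * n) → ℝ) :
    ∑ k, f k = ∑ i : Fin n, (f (evenIdx i) + f (oddIdx i)) := by
  rw [← Equiv.sum_comp (finProdFinEquiv.trans (finCongr (mul_comm n 2))) f,
    Fintype.sum_prod_type]
  refine Finset.sum_congr rfl fun i _ => ?_
  rw [Fin.sum_univ_two]
  congr 2 <;> ext <;> simp [evenIdx, oddIdx, finProdFinEquiv, add_comm]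

section Omega
variable {n : ℕ} (i j : Fin n)

theorem Omega_even_even : Omega n (evenIdx i) (evenIdx j) = 0 := by
  simp only [Omega, evenIdx, of_apply]
  rw [if_neg (by omega), if_neg (by omega)]

theorem Omega_odd_odd : Omega n (oddIdx i) (oddIdx j) = 0 := by
  simp only [Omega, oddIdx, of_apply]
  rw [if_neg (by omega), if_neg (by omega)]

theorem Omega_even_odd : Omega n (evenIdx i) (oddIdx j) = if i = j then 1 else 0 := by
  simp only [Omega, evenIdx, oddIdx, of_apply, Fin.ext_iff]
  split_ifs <;> first | rfl | omega

theorem Omega_odd_even : Omega n (oddIdx i) (evenIdx j) = if i = j then -1 else 0 := by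
  simp only [Omega, evenIdx, oddIdx, of_apply, Fin.ext_iff]
  split_ifs <;> first | rfl | omega

variable {R : Matrix (Fin (2 * n)) (Fin (2 * n)) ℝ}

theorem odd_odd_of_commute_Omega (hR : R * Omega n = Omega n * R) :
    R (oddIdx i) (oddIdx j) = R (evenIdx i) (evenIdx j) := by
  have h := congrFun (congrFun hR (evenIdx i)) (oddIdx j)
  simpa [mul_apply, sum_fin_two_mul, Omega_even_even, Omega_odd_odd, Omega_even_odd,
    Omega_odd_even] using h.symm

theorem odd_even_of_commute_Omega (hR : R * Omega n = Omega n * R) :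
    R (oddIdx i) (evenIdx j) = -R (evenIdx i) (oddIdx j) := by
  have h := congrFun (congrFun hR (evenIdx i)) (evenIdx j)
  simpa [mul_apply, sum_fin_two_mul, Omega_even_even, Omega_odd_odd, Omega_even_odd,
    Omega_odd_even] using h.symm

end Omega

/-- The mode-to-mode weights of an orthogonal symplectic matrix. -/
def modeWeights {n : ℕ} (R : Matrix (Fin (2 * n)) (Fin (2 * n)) ℝ) : Matrix (Fin n) (Fin n) ℝ :=
  of fun i j => R (evenIdx i) (evenIdx j) ^ 2 + R (evenIdx i) (oddIdx j) ^ 2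

theorem modeWeights_mem_doublyStochastic {n : ℕ} {R : Matrix (Fin (2 * n)) (Fin (2 * n)) ℝ}
    (hR : R * Omega n = Omega n * R) (hO : R * Rᵀ = 1) :
    modeWeights R ∈ doublyStochastic ℝ (Fin n) := by
  have hO' : Rᵀ * R = 1 := mul_eq_one_comm.mp hO
  refine mem_doublyStochastic_iff_sum.mpr ⟨fun i j => ?_, fun i => ?_, fun j => ?_⟩
  · simp only [modeWeights, of_apply]
    positivity
  · have h := congrFun (congrFun hO (evenIdx i)) (evenIdx i)
    simpa [mul_apply, sum_fin_two_mul, modeWeights, sq] using h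
  · have h := congrFun (congrFun hO' (evenIdx j)) (evenIdx j)
    simpa [mul_apply, sum_fin_two_mul, modeWeights, sq, odd_even_of_commute_Omega _ _ hR] using h

theorem trace_squeezeDiag_conj {n : ℕ} (z y : Fin n → ℝ)
    {R : Matrix (Fin (2 * n)) (Fin (2 * n)) ℝ} (hR : R * Omega n = Omega n * R) :
    trace (squeezeDiag n z * R * pairDiag n y * (squeezeDiag n z * R)ᵀ)
      = ∑ i, ∑ j, (z i ^ 2 + (z i)⁻¹ ^ 2) * modeWeights R i j * y j := by
  have hdiv (i : Fin n) : (2 * (i : ℕ) + 1) / 2 = i := by omega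
  rw [squeezeDiag, pairDiag, trace_diagonal_conj, sum_fin_two_mul]
  refine Finset.sum_congr rfl fun i _ => ?_
  rw [sum_fin_two_mul, sum_fin_two_mul, ← Finset.sum_add_distrib]
  refine Finset.sum_congr rfl fun j _ => ?_
  rw [odd_odd_of_commute_Omega _ _ hR, odd_even_of_commute_Omega _ _ hR]
  simp [evenIdx, oddIdx, modeWeights, hdiv, Nat.add_mod]
  ring

theorem trace_squeezeDiag {n : ℕ} (z y : Fin n → ℝ) :
    trace (squeezeDiag n z * pairDiag n y * (squeezeDiag n z)ᵀ)
      = ∑ i, (z i ^ 2 + (z i)⁻¹ ^ 2) * y i := by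
  have h := trace_squeezeDiag_conj z y (R := 1) (by simp)
  have hw : modeWeights (1 : Matrix (Fin (2 * n)) (Fin (2 * n)) ℝ) = 1 := by
    ext i j
    have h1 : evenIdx i ≠ oddIdx j := fun h => by
      simp only [evenIdx, oddIdx, Fin.mk.injEq] at h
      omega
    have h2 : evenIdx i = evenIdx j ↔ i = j := by simp [evenIdx, Fin.ext_iff]
    simp [modeWeights, one_apply, h1, h2]
  simpa [hw, one_apply] using h

theorem statement1 (n : ℕ) (hn : 1 ≤ n) (y : Fin n → ℝ)
    (hy : ∀ i, 0 < y i) (hymono : ∀ i j : Fin n, i ≤ j → y j ≤ y i)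
    (zbar : Fin n → ℝ) (hzbar : ∀ i, 1 ≤ zbar i)
    (hzmono : ∀ i j : Fin n, i ≤ j → zbar j ≤ zbar i) :
    IsGreatest
      { x : ℝ | ∃ (R₁ R₂ : Matrix (Fin (2*n)) (Fin (2*n)) ℝ) (z : Fin n → ℝ),
          R₁ * Omega n * R₁ᵀ = Omega n ∧ R₁ * R₁ᵀ = 1 ∧
          R₂ * Omega n * R₂ᵀ = Omega n ∧ R₂ * R₂ᵀ = 1 ∧
          (∀ i, 1 ≤ z i ∧ z i ≤ zbar i) ∧
          x = Matrix.trace ((R₁ * squeezeDiag n z * R₂) * pairDiag n y *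
                (R₁ * squeezeDiag n z * R₂)ᵀ) }
      (∑ i, (zbar i ^ 2 + ((zbar i)⁻¹) ^ 2) * y i)
    ∧ Matrix.trace (squeezeDiag n zbar * pairDiag n y * (squeezeDiag n zbar)ᵀ)
        = ∑ i, (zbar i ^ 2 + ((zbar i)⁻¹) ^ 2) * y i := by
  refine ⟨⟨⟨1, 1, zbar, by simp, by simp, by simp, by simp, fun i => ⟨hzbar i, le_rfl⟩, ?_⟩, ?_⟩,
    trace_squeezeDiag zbar y⟩
  · simpa using (trace_squeezeDiag zbar y).symm
  rintro _ ⟨R₁, R₂, z, -, hO₁, hS₂, hO₂, hz, rfl⟩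
  have hO₁' : R₁ᵀ * R₁ = 1 := mul_eq_one_comm.mp hO₁
  have hO₂' : R₂ᵀ * R₂ = 1 := mul_eq_one_comm.mp hO₂
  have hcomm : R₂ * Omega n = Omega n * R₂ := by
    rw [← mul_one (R₂ * Omega n), ← hO₂', ← Matrix.mul_assoc, hS₂]
  have htrace : trace (R₁ * squeezeDiag n z * R₂ * pairDiag n y * (R₁ * squeezeDiag n z * R₂)ᵀ)
      = trace (squeezeDiag n z * R₂ * pairDiag n y * (squeezeDiag n z * R₂)ᵀ) := by
    rw [Matrix.mul_assoc R₁, transpose_mul R₁, ← Matrix.mul_assoc, trace_mul_comm]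
    simp only [← Matrix.mul_assoc, hO₁', Matrix.one_mul]
  have hP := modeWeights_mem_doublyStochastic hcomm hO₂
  have hmono : Monovary (fun i => zbar i ^ 2 + (zbar i)⁻¹ ^ 2) y := fun i j hij =>
    add_inv_sq_le_add_inv_sq (hzbar i)
      (hzmono j i (le_of_not_ge fun h => hij.not_ge (hymono i j h)))
  rw [htrace, trace_squeezeDiag_conj z y hcomm]
  refine le_trans ?_ (hmono.sum_mul_doublyStochastic_mul_le hP)
  refine Finset.sum_le_sum fun i _ => Finset.sum_le_sum fun j _ => ?_
  exact mul_le_mul_of_nonneg_right (mul_le_mul_of_nonneg_right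
    (add_inv_sq_le_add_inv_sq (hz i).1 (hz i).2) (nonneg_of_mem_doublyStochastic hP)) (hy j).le
end

section
/- Let n ≥ 1, let y₁, …, yₙ > 0 and set Y = ⊕_{i=1}^n y_i I₂. Then tr[Y] is the least element of the set {tr[S Y Sᵀ] : S symplectic}; in particular tr[S Y Sᵀ] ≥ tr[Y] for every symplectic 2n×2n real matrix S, with equality at S = I. -/
open Matrix BigOperators

theorem Omega_transpose (n : ℕ) : (Omega n)ᵀ = -Omega n := by
  ext i j
  rw [transpose_apply, neg_apply]
  simp only [Omega, of_apply]
  split_ifs <;> first | omega | norm_num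

theorem Omega_mul_Omega (n : ℕ) : Omega n * Omega n = -1 := by
  ext i k
  have hi := i.isLt
  rw [mul_apply, neg_apply, one_apply]
  obtain ⟨p, hp⟩ : ∃ p : Fin (2 * n),
      (i.val % 2 = 0 ∧ p.val = i.val + 1) ∨ (i.val % 2 = 1 ∧ i.val = p.val + 1) := by
    rcases Nat.mod_two_eq_zero_or_one i.val with h | h
    · exact ⟨⟨i.val + 1, by omega⟩, Or.inl ⟨h, rfl⟩⟩
    · exact ⟨⟨i.val - 1, by omega⟩, Or.inr ⟨h, by simp only; omega⟩⟩
  rw [Finset.sum_eq_single p]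
  · simp only [Omega, of_apply, Fin.ext_iff]
    split_ifs <;> first | omega | norm_num
  · intro j _ hj
    have hj' : j.val ≠ p.val := fun h => hj (Fin.ext h)
    have : Omega n i j = 0 := by
      simp only [Omega, of_apply]
      split_ifs <;> first | omega | rfl
    rw [this, zero_mul]
  · simp

theorem Omega_mul_pairDiag (n : ℕ) (y : Fin n → ℝ) :
    Omega n * pairDiag n y = pairDiag n y * Omega n := by
  ext i j
  rw [pairDiag, mul_diagonal, diagonal_mul, mul_comm]
  by_cases h : i.val / 2 = j.val / 2
  · simp only [h]
  · have : Omega n i j = 0 := by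
      simp only [Omega, of_apply]
      split_ifs <;> first | omega | rfl
    simp [this]

theorem transpose_mul_Omega_mul {n : ℕ} {S : Matrix (Fin (2 * n)) (Fin (2 * n)) ℝ}
    (hS : S * Omega n * Sᵀ = Omega n) : Sᵀ * Omega n * S = Omega n := by
  have h1 : S * -(Omega n * Sᵀ * Omega n) = 1 := by
    rw [Matrix.mul_neg, ← Matrix.mul_assoc, ← Matrix.mul_assoc, hS, Omega_mul_Omega, neg_neg]
  have h2 := mul_eq_one_comm.mp h1
  calc Sᵀ * Omega n * S = -(Omega n * Omega n) * (Sᵀ * Omega n * S) := by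
        rw [Omega_mul_Omega, neg_neg, Matrix.one_mul]
    _ = Omega n * (-(Omega n * Sᵀ * Omega n) * S) := by
        simp only [Matrix.neg_mul, Matrix.mul_neg, Matrix.mul_assoc]
    _ = Omega n := by rw [h2, Matrix.mul_one]

theorem trace_mul_pairDiag_mul_transpose_nonneg {n : ℕ} {y : Fin n → ℝ} (hy : ∀ i, 0 ≤ y i)
    (A : Matrix (Fin (2 * n)) (Fin (2 * n)) ℝ) : 0 ≤ trace (A * pairDiag n y * Aᵀ) := by
  refine Finset.sum_nonneg fun i _ => ?_
  rw [diag_apply, mul_apply]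
  refine Finset.sum_nonneg fun j _ => ?_
  rw [pairDiag, mul_diagonal, transpose_apply, mul_right_comm]
  exact mul_nonneg (mul_self_nonneg _) (hy _)

/-- The trace of `S Y Sᵀ` is at least that of `Y`, by positivity of the weighted norm
of `S + Ω S Ω`. -/
theorem trace_pairDiag_le {n : ℕ} {y : Fin n → ℝ} (hy : ∀ i, 0 ≤ y i)
    {S : Matrix (Fin (2 * n)) (Fin (2 * n)) ℝ} (hS : S * Omega n * Sᵀ = Omega n) :
    trace (pairDiag n y) ≤ trace (S * pairDiag n y * Sᵀ) := by
  have hpos := trace_mul_pairDiag_mul_transpose_nonneg hy (S + Omega n * S * Omega n)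
  have hS' := transpose_mul_Omega_mul hS
  have hT := Omega_transpose n
  have hsq := Omega_mul_Omega n
  have hcomm := Omega_mul_pairDiag n y
  set W := Omega n
  set Y := pairDiag n y
  have hWYW : W * Y * W = -Y := by rw [hcomm, Matrix.mul_assoc, hsq, Matrix.mul_neg, Matrix.mul_one]
  have ht : (S + W * S * W)ᵀ = Sᵀ + W * Sᵀ * W := by
    simp [transpose_mul, hT, Matrix.mul_assoc]
  have hdiag : trace (W * S * W * Y * (W * Sᵀ * W)) = trace (S * Y * Sᵀ) := by
    calc trace (W * S * W * Y * (W * Sᵀ * W)) = trace (W * (S * (W * Y * W) * Sᵀ * W)) := by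
          simp only [Matrix.mul_assoc]
      _ = trace (S * (W * Y * W) * Sᵀ * (W * W)) := by
          rw [trace_mul_comm]; simp only [Matrix.mul_assoc]
      _ = trace (S * Y * Sᵀ) := by rw [hWYW, hsq]; simp
  have hcross₁ : trace (W * S * W * Y * Sᵀ) = -trace Y := by
    calc trace (W * S * W * Y * Sᵀ) = trace (Sᵀ * W * S * (W * Y)) := by
          rw [trace_mul_comm]; simp only [Matrix.mul_assoc]
      _ = -trace Y := by rw [hS', ← Matrix.mul_assoc, hsq]; simp
  have hcross₂ : trace (S * Y * (W * Sᵀ * W)) = -trace Y := by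
    calc trace (S * Y * (W * Sᵀ * W)) = trace (S * (Y * W * Sᵀ * W)) := by
          simp only [Matrix.mul_assoc]
      _ = trace (Y * W * (Sᵀ * W * S)) := by
          rw [trace_mul_comm]; simp only [Matrix.mul_assoc]
      _ = -trace Y := by rw [hS', Matrix.mul_assoc, hsq]; simp
  rw [ht] at hpos
  simp only [Matrix.add_mul, Matrix.mul_add, trace_add, hdiag, hcross₁, hcross₂] at hpos
  linarith

theorem statement2 (n : ℕ) (hn : 1 ≤ n) (y : Fin n → ℝ) (hy : ∀ i, 0 < y i) :
    IsLeast
      { x : ℝ | ∃ S : Matrix (Fin (2*n)) (Fin (2*n)) ℝ,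
          S * Omega n * Sᵀ = Omega n ∧
          x = Matrix.trace (S * pairDiag n y * Sᵀ) }
      (Matrix.trace (pairDiag n y))
    ∧ Matrix.trace ((1 : Matrix (Fin (2*n)) (Fin (2*n)) ℝ) * pairDiag n y * (1 : Matrix (Fin (2*n)) (Fin (2*n)) ℝ)ᵀ)
        = Matrix.trace (pairDiag n y) := by
  refine ⟨⟨⟨1, by simp, by simp⟩, ?_⟩, by simp⟩
  rintro x ⟨S, hS, rfl⟩
  exact trace_pairDiag_le (fun i => (hy i).le) hS
end

section
/- Let α, β ∈ ℝ^m and let α↓, β↓ denote their decreasing rearrangements. Then the value Σ_{i=1}^m α↓_i β↓_i is the greatest element of the set {αᵀ X β : X an m×m doubly stochastic matrix}; in particular αᵀ X β ≤ Σ_{i=1}^m α↓_i β↓_i for every doubly stochastic X, and the bound is attained (at a permutation matrix). -/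
open Matrix BigOperators

/-- If reorderings of `f` and `g` monovary, their inner product dominates that of `f` with any
permutation of `g`. -/
lemma Monovary.dotProduct_comp_perm_le {n : Type*} [Fintype n] {f g : n → ℝ}
    {π τ : Equiv.Perm n} (h : Monovary (f ∘ π) (g ∘ τ)) (σ : Equiv.Perm n) :
    f ⬝ᵥ (g ∘ σ) ≤ (f ∘ π) ⬝ᵥ (g ∘ τ) := by
  have key := h.sum_mul_comp_perm_le_sum_mul (σ := π.trans (σ.trans τ.symm))
  simp only [Function.comp_apply, Equiv.trans_apply, Equiv.apply_symm_apply] at key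
  rw [Equiv.sum_comp π fun i => f i * g (σ i)] at key
  exact key

/-- An upper bound for `f ᵀ X g` over permutation matrices `X` also holds for every doubly
stochastic `X`. -/
lemma dotProduct_mulVec_le_of_mem_doublyStochastic {n : Type*} [Fintype n] [DecidableEq n]
    {f g : n → ℝ} {c : ℝ} (hc : ∀ σ : Equiv.Perm n, f ⬝ᵥ (g ∘ σ) ≤ c)
    {X : Matrix n n ℝ} (hX : X ∈ doublyStochastic ℝ n) :
    f ⬝ᵥ (X *ᵥ g) ≤ c := by
  obtain ⟨w, hw, hw_sum, rfl⟩ := exists_eq_sum_perm_of_mem_doublyStochastic hX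
  calc f ⬝ᵥ ((∑ σ, w σ • σ.permMatrix ℝ) *ᵥ g)
      = ∑ σ, w σ * (f ⬝ᵥ (g ∘ σ)) := by
        simp [Matrix.sum_mulVec, dotProduct_sum, Matrix.smul_mulVec, Matrix.permMatrix_mulVec]
    _ ≤ ∑ σ, w σ * c := Finset.sum_le_sum fun σ _ => mul_le_mul_of_nonneg_left (hc σ) (hw σ)
    _ = c := by rw [← Finset.sum_mul, hw_sum, one_mul]

theorem statement11 (m : ℕ) (α β αd βd : Fin m → ℝ)
    (πa : Equiv.Perm (Fin m)) (hαd : αd = α ∘ πa)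
    (hαdanti : ∀ i j : Fin m, i ≤ j → αd j ≤ αd i)
    (πb : Equiv.Perm (Fin m)) (hβd : βd = β ∘ πb)
    (hβdanti : ∀ i j : Fin m, i ≤ j → βd j ≤ βd i) :
    IsGreatest
      { x : ℝ | ∃ X : Matrix (Fin m) (Fin m) ℝ,
          (∀ i j, 0 ≤ X i j) ∧ (∀ i, ∑ j, X i j = 1) ∧ (∀ j, ∑ i, X i j = 1) ∧
          x = ∑ i, ∑ j, α i * X i j * β j }
      (∑ i, αd i * βd i) := by
  have bilin (X : Matrix (Fin m) (Fin m) ℝ) :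
      ∑ i, ∑ j, α i * X i j * β j = α ⬝ᵥ (X *ᵥ β) := by
    simp [dotProduct, Matrix.mulVec, Finset.mul_sum, mul_assoc]
  have hmono : Monovary (α ∘ πa) (β ∘ πb) :=
    Antitone.monovary (fun i j h => hαd ▸ hαdanti i j h) (fun i j h => hβd ▸ hβdanti i j h)
  simp only [bilin]
  subst hαd hβd
  constructor
  · have hP : (πb * πa⁻¹).permMatrix ℝ ∈ doublyStochastic ℝ (Fin m) :=
      permMatrix_mem_doublyStochastic
    rw [mem_doublyStochastic_iff_sum] at hP
    refine ⟨_, hP.1, hP.2.1, hP.2.2, ?_⟩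
    rw [Matrix.permMatrix_mulVec, dotProduct,
      ← Equiv.sum_comp πa fun i => α i * (β ∘ (πb * πa⁻¹)) i]
    simp
  · rintro _ ⟨X, h_nonneg, h_row, h_col, rfl⟩
    exact dotProduct_mulVec_le_of_mem_doublyStochastic hmono.dotProduct_comp_perm_le
      (mem_doublyStochastic_iff_sum.2 ⟨h_nonneg, h_row, h_col⟩)
end

section
/- Let α, β ∈ ℝ^m, let α↑ denote the increasing rearrangement of α, and β↓ the decreasing rearrangement of β. Then the value Σ_{i=1}^m α↑_i β↓_i is the least element of the set {αᵀ X β : X an m×m doubly stochastic matrix}; in particular αᵀ X β ≥ Σ_{i=1}^m α↑_i β↓_i for every doubly stochastic X, and the bound is attained (at a permutation matrix). -/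
theorem sum_mul_permMatrix_mul {n R : Type*} [Fintype n] [DecidableEq n] [CommSemiring R]
    (σ : Equiv.Perm n) (a b : n → R) :
    ∑ i, ∑ j, a i * σ.permMatrix R i j * b j = ∑ i, a i * b (σ i) := by
  simp [Equiv.Perm.permMatrix, PEquiv.toMatrix_apply, Equiv.toPEquiv_apply]

/-- A lower bound for the bilinear form of all permutation matrices is a lower bound for the
bilinear form of all doubly stochastic matrices. -/
theorem le_sum_of_mem_doublyStochastic {n R : Type*} [Fintype n] [DecidableEq n] [Field R]
    [LinearOrder R] [IsStrictOrderedRing R] {M : Matrix n n R} (hM : M ∈ doublyStochastic R n)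
    (a b : n → R) (c : R) (hc : ∀ σ : Equiv.Perm n, c ≤ ∑ i, a i * b (σ i)) :
    c ≤ ∑ i, ∑ j, a i * M i j * b j := by
  obtain ⟨w, hw, hw_sum, rfl⟩ := exists_eq_sum_perm_of_mem_doublyStochastic hM
  calc
    c = ∑ σ, w σ * c := by rw [← Finset.sum_mul, hw_sum, one_mul]
    _ ≤ ∑ σ, w σ * ∑ i, a i * b (σ i) := by
      gcongr with σ
      · exact hw σ
      · exact hc σ
    _ = ∑ σ, ∑ i, ∑ j, a i * (w σ * σ.permMatrix R i j) * b j := by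
      refine Finset.sum_congr rfl fun σ _ ↦ ?_
      simp only [← sum_mul_permMatrix_mul σ a b, Finset.mul_sum]
      exact Finset.sum_congr rfl fun i _ ↦ Finset.sum_congr rfl fun j _ ↦ by ring
    _ = ∑ i, ∑ j, a i * (∑ σ, w σ • σ.permMatrix R) i j * b j := by
      simp only [Matrix.sum_apply, Matrix.smul_apply, smul_eq_mul, Finset.mul_sum, Finset.sum_mul]
      rw [Finset.sum_comm]
      exact Finset.sum_congr rfl fun i _ ↦ Finset.sum_comm

theorem statement12 (m : ℕ) (α β αu βd : Fin m → ℝ)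
    (πa : Equiv.Perm (Fin m)) (hαu : αu = α ∘ πa)
    (hαumono : ∀ i j : Fin m, i ≤ j → αu i ≤ αu j)
    (πb : Equiv.Perm (Fin m)) (hβd : βd = β ∘ πb)
    (hβdanti : ∀ i j : Fin m, i ≤ j → βd j ≤ βd i) :
    IsLeast
      { x : ℝ | ∃ X : Matrix (Fin m) (Fin m) ℝ,
          (∀ i j, 0 ≤ X i j) ∧ (∀ i, ∑ j, X i j = 1) ∧ (∀ j, ∑ i, X i j = 1) ∧
          x = ∑ i, ∑ j, α i * X i j * β j }
      (∑ i, αu i * βd i) := by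
  constructor
  · obtain ⟨h_nonneg, h_row, h_col⟩ := mem_doublyStochastic_iff_sum.1
      (permMatrix_mem_doublyStochastic (R := ℝ) (σ := πb * πa⁻¹))
    refine ⟨_, h_nonneg, h_row, h_col, ?_⟩
    rw [sum_mul_permMatrix_mul, ← Equiv.sum_comp πa fun i ↦ α i * β ((πb * πa⁻¹) i)]
    simp [hαu, hβd]
  · rintro _ ⟨X, h_nonneg, h_row, h_col, rfl⟩
    refine le_sum_of_mem_doublyStochastic
      (mem_doublyStochastic_iff_sum.2 ⟨h_nonneg, h_row, h_col⟩) _ _ _ fun σ ↦ ?_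
    have h_mono : Monotone αu := fun i j ↦ hαumono i j
    have h_anti : Antitone βd := fun i j ↦ hβdanti i j
    refine ((h_mono.antivary h_anti).sum_mul_le_sum_mul_comp_perm (σ := πb⁻¹ * σ * πa)).trans_eq ?_
    rw [← Equiv.sum_comp πa fun i ↦ α i * β (σ i)]
    simp [hαu, hβd]
end
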